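/- There exists an absolute constant c > 0 with the following property. Let G be an abelian group, A a finite nonempty subset of G, and β, γ ∈ (0,1] with β ≤ 1/2. Suppose that A is (3,β,γ)-connected and that E₃(A) ≥ 2⁴·γ⁻¹·|A|³. Then (max_{s ≠ 0} |A − A_s|)² ≥ c·γ·|A|⁵/E(A) and (max_{s ≠ 0} |A + A_s|)² ≥ c·γ·|A|⁵/E(A), where the maxima are taken over all nonzero s ∈ G. -/

import Mathlib

open Finset Pointwise

universe u

variable {G : Type*} [AddCommGroup G] [DecidableEq G]

/-- `A_s = A ∩ (A - s) = {x ∈ A : x + s ∈ A}`. -/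
def stab (A : Finset G) (s : G) : Finset G := A ∩ A.image (fun a => a - s)

/-- `E_k(A) = ∑_{s ∈ G} |A_s|^k` (the summand vanishes off `A - A`). -/
def energyK (k : ℕ) (A : Finset G) : ℕ := ∑ s ∈ A - A, (stab A s).card ^ k

/-- The additive energy `E(A)`. -/
def energy (A : Finset G) : ℕ := energyK 2 A

/-- `(k, β, γ)`-connectedness: every `B ⊆ A` with `|B| ≥ β|A|` satisfies
`E_k(B) ≥ γ (|B|/|A|)^{2k} E_k(A)`. -/
def conn (k : ℕ) (β γ : ℝ) (A : Finset G) : Prop :=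
  ∀ B ⊆ A, β * (A.card : ℝ) ≤ (B.card : ℝ) →
    γ * ((B.card : ℝ) / (A.card : ℝ)) ^ (2 * k) * (energyK k A : ℝ) ≤ (energyK k B : ℝ)

theorem mem_stab' {G : Type*} [AddCommGroup G] [DecidableEq G] (A : Finset G) (s x : G) :
    x ∈ stab A s ↔ x ∈ A ∧ x + s ∈ A := by
  unfold stab
  simp only [mem_inter, mem_image]
  constructor
  · rintro ⟨h, a, ha, rfl⟩
    exact ⟨h, by simpa using ha⟩
  · rintro ⟨h, h2⟩
    exact ⟨h, x + s, h2, by simp⟩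

/-- The energy `E(S,T)` written through differences of `T`. -/
def crossE {G : Type*} [AddCommGroup G] [DecidableEq G] (S T : Finset G) : ℕ :=
  ∑ a ∈ T, ∑ b ∈ T, (stab S (a - b)).card

theorem card_stab_eq {G : Type*} [AddCommGroup G] [DecidableEq G] (A : Finset G) (t : G) :
    (stab A t).card = ((A ×ˢ A).filter (fun p => p.1 - p.2 = t)).card := by
  refine card_bij' (fun x _ => (x + t, x)) (fun p _ => p.2) ?_ ?_ ?_ ?_
  · intro x hx
    rw [mem_stab'] at hx
    simp [hx.1, hx.2]
  · rintro ⟨p, q⟩ h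
    simp only [mem_filter, mem_product] at h
    rw [mem_stab']
    refine ⟨h.1.2, ?_⟩
    rw [← h.2]; simpa using h.1.1
  · intro x hx; rfl
  · rintro ⟨p, q⟩ h
    simp only [mem_filter, mem_product] at h
    simp [← h.2]

theorem card_stab_neg {G : Type*} [AddCommGroup G] [DecidableEq G] (A : Finset G) (t : G) :
    (stab A (-t)).card = (stab A t).card := by
  refine card_bij' (fun x _ => x - t) (fun x _ => x + t) ?_ ?_ ?_ ?_
  · intro x hx
    rw [mem_stab'] at hx ⊢
    refine ⟨by simpa [sub_eq_add_neg] using hx.2, by simpa using hx.1⟩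
  · intro x hx
    rw [mem_stab'] at hx ⊢
    refine ⟨hx.2, by simpa using hx.1⟩
  · intro x hx; simp
  · intro x hx; simp

theorem sum_diff {G : Type*} [AddCommGroup G] [DecidableEq G] (A : Finset G) (f : G → ℕ) :
    ∑ a ∈ A, ∑ b ∈ A, f (a - b) = ∑ t ∈ A - A, (stab A t).card * f t := by
  rw [← sum_product' A A (fun a b => f (a - b))]
  rw [← sum_fiberwise_of_maps_to (s := A ×ˢ A) (t := A - A) (g := fun p => p.1 - p.2)]
  · refine sum_congr rfl fun t _ => ?_
    rw [card_stab_eq, card_eq_sum_ones, sum_mul]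
    refine sum_congr rfl fun p hp => ?_
    rw [(mem_filter.1 hp).2]; simp
  · intro p hp
    rw [mem_product] at hp
    exact sub_mem_sub hp.1 hp.2

theorem energy_eq {G : Type*} [AddCommGroup G] [DecidableEq G] (A : Finset G) :
    energy A = crossE A A := by
  unfold energy energyK crossE
  rw [sum_diff A (fun t => (stab A t).card)]
  refine sum_congr rfl fun t _ => by ring

theorem addEnergy_eq_crossE {G : Type*} [AddCommGroup G] [DecidableEq G] (S T : Finset G) :
    addEnergy S T = crossE S T := by
  unfold addEnergy crossE
  rw [← sum_product' T T (fun a b => (stab S (a - b)).card)]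
  rw [card_eq_sum_card_fiberwise (f := fun x => x.2) (t := T ×ˢ T)]
  · refine sum_congr rfl fun p hp => ?_
    rw [mem_product] at hp
    refine card_bij' (fun x _ => x.1.1) (fun x _ => ((x, x + (p.1 - p.2)), p)) ?_ ?_ ?_ ?_
    · rintro ⟨⟨a, b⟩, q⟩ h
      simp only [mem_filter, mem_product] at h
      obtain ⟨⟨⟨⟨h1, h2⟩, h3⟩, h4⟩, rfl⟩ := h
      rw [mem_stab']
      refine ⟨h1, ?_⟩
      have : a + (q.1 - q.2) = b := by rw [← add_sub_assoc, h4]; simp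
      rw [this]; exact h2
    · intro x hx
      rw [mem_stab'] at hx
      simp only [mem_filter, mem_product]
      refine ⟨⟨⟨hx, hp⟩, ?_⟩, trivial⟩
      abel
    · rintro ⟨⟨a, b⟩, q⟩ h
      simp only [mem_filter, mem_product] at h
      obtain ⟨⟨⟨⟨h1, h2⟩, h3⟩, h4⟩, rfl⟩ := h
      have : a + (q.1 - q.2) = b := by rw [← add_sub_assoc, h4]; simp
      simp [this]
    · intro x hx; rfl
  · intro x hx
    simp only [coe_filter, Set.mem_ofPred_eq, mem_product] at hx
    simp [hx.1.2]

theorem cs_add {G : Type*} [AddCommGroup G] [DecidableEq G] (S T : Finset G) :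
    S.card ^ 2 * T.card ^ 2 ≤ (S + T).card * crossE S T := by
  rw [← addEnergy_eq_crossE]; exact le_card_add_mul_addEnergy S T

theorem crossE_neg {G : Type*} [AddCommGroup G] [DecidableEq G] (S T : Finset G) :
    crossE S (-T) = crossE S T := by
  unfold crossE
  simp only [sum_neg_index]
  refine sum_congr rfl fun a _ => sum_congr rfl fun b _ => ?_
  rw [← card_stab_neg]
  congr 2; abel

theorem cs_sub {G : Type*} [AddCommGroup G] [DecidableEq G] (S T : Finset G) :
    S.card ^ 2 * T.card ^ 2 ≤ (S - T).card * crossE S T := by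
  have := cs_add S (-T)
  rwa [crossE_neg, card_neg, ← sub_eq_add_neg] at this

theorem sum_crossE {G : Type*} [AddCommGroup G] [DecidableEq G] (B : Finset G) :
    ∑ s ∈ B - B, crossE B (stab B s) ≤ energyK 3 B := by
  have h1 : energyK 3 B =
      ∑ a ∈ B, ∑ b ∈ B, (stab B (a - b)).card * (stab B (a - b)).card := by
    rw [sum_diff B (fun t => (stab B t).card * (stab B t).card)]
    exact sum_congr rfl fun t _ => by ring
  rw [h1]
  have h2 : ∀ s, crossE B (stab B s) = ∑ a ∈ B, ∑ b ∈ B,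
      if a ∈ stab B s ∧ b ∈ stab B s then (stab B (a - b)).card else 0 := by
    intro s
    have hf : stab B s = B.filter (fun a => a ∈ stab B s) := by
      ext x; simp only [mem_filter, mem_stab']; tauto
    unfold crossE
    conv_lhs => rw [hf]
    rw [sum_filter]
    refine sum_congr rfl fun a _ => ?_
    rw [← hf]
    by_cases ha : a ∈ stab B s
    · simp only [ha, true_and, if_true]
      conv_lhs => rw [hf]
      rw [sum_filter]
    · simp [ha]
  simp only [h2]
  rw [sum_comm]
  refine sum_le_sum fun a ha => ?_
  rw [sum_comm]
  refine sum_le_sum fun b hb => ?_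
  rw [← sum_filter, sum_const, smul_eq_mul]
  refine Nat.mul_le_mul_right _ ?_
  refine card_le_card_of_injOn (fun s => b + s) ?_ ?_
  · intro s hs
    simp only [coe_filter, Set.mem_ofPred_eq, mem_stab'] at hs
    simp only [mem_coe, mem_stab']
    refine ⟨hs.2.2.2, ?_⟩
    have : b + s + (a - b) = a + s := by abel
    rw [this]; exact hs.2.1.2
  · intro x _ y _ h
    simpa using h

theorem stab_zero' {G : Type*} [AddCommGroup G] [DecidableEq G] (B : Finset G) :
    stab B 0 = B := by
  ext x; simp [mem_stab']

theorem stab_mono' {G : Type*} [AddCommGroup G] [DecidableEq G] {A B : Finset G} (h : B ⊆ A)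
    (s : G) : stab B s ⊆ stab A s := by
  intro x; simp only [mem_stab']; exact fun hx => ⟨h hx.1, h hx.2⟩

theorem exists_good {G : Type*} [AddCommGroup G] [DecidableEq G] (B : Finset G)
    (hB : B.Nonempty) (h : 2 * B.card ^ 3 ≤ energyK 3 B) :
    ∃ s, s ≠ 0 ∧ (stab B s).Nonempty ∧ crossE B (stab B s) ≤ 2 * (stab B s).card ^ 3 := by
  by_contra! hc
  have hpos : 0 < B.card := hB.card_pos
  have h0 : (0 : G) ∈ B - B := by
    obtain ⟨x, hx⟩ := hB
    exact mem_sub.2 ⟨x, hx, x, hx, sub_self x⟩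
  have e1 : energyK 3 B = ∑ s ∈ (B - B).erase 0, (stab B s).card ^ 3 + B.card ^ 3 := by
    unfold energyK
    rw [← sum_erase_add _ _ h0, stab_zero']
  have e2 : ∑ s ∈ (B - B).erase 0, crossE B (stab B s) ≤ energyK 3 B :=
    (sum_le_sum_of_subset (erase_subset _ _)).trans (sum_crossE B)
  have hp3 : 0 < B.card ^ 3 := by positivity
  have hne : ∃ s ∈ (B - B).erase 0, 0 < (stab B s).card ^ 3 := by
    by_contra! hn
    have : ∑ s ∈ (B - B).erase 0, (stab B s).card ^ 3 = 0 :=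
      sum_eq_zero fun s hs => Nat.le_zero.1 (hn s hs)
    omega
  obtain ⟨s, hs, hsp⟩ := hne
  have hlt : ∑ s ∈ (B - B).erase 0, 2 * (stab B s).card ^ 3
      < ∑ s ∈ (B - B).erase 0, crossE B (stab B s) := by
    refine sum_lt_sum (fun t ht => ?_) ⟨s, hs, ?_⟩
    · rcases (stab B t).eq_empty_or_nonempty with he | he
      · simp [he]
      · exact (hc t (ne_of_mem_erase ht) he).le
    · refine hc s (ne_of_mem_erase hs) ?_
      rw [← card_pos]; exact Nat.pos_of_ne_zero (by rintro h; simp [h] at hsp)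
  rw [← mul_sum] at hlt
  omega

theorem exists_sub {G : Type*} [AddCommGroup G] [DecidableEq G] (A : Finset G)
    (hA : A.Nonempty) :
    ∃ B ⊆ A, A.card ≤ 2 * B.card ∧
      ∀ T ⊆ B, A.card * crossE A T ≤ T.card * (2 * energy A) := by
  classical
  set d : G → ℕ := fun a => ∑ b ∈ A, (stab A (a - b)).card with hd
  have hE : energy A = ∑ a ∈ A, d a := energy_eq A
  have hEpos : 0 < energy A := by
    rw [energy_eq, ← addEnergy_eq_crossE]; exact addEnergy_self_pos hA
  refine ⟨A.filter (fun a => A.card * d a ≤ 2 * energy A), filter_subset _ _, ?_, ?_⟩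
  · have hs := card_filter_add_card_filter_not (s := A) (fun a => A.card * d a ≤ 2 * energy A)
    have h1 : (A.filter (fun a => ¬ A.card * d a ≤ 2 * energy A)).card * (2 * energy A)
        ≤ A.card * energy A := by
      have hAE : A.card * energy A = ∑ a ∈ A, A.card * d a := by rw [hE, mul_sum]
      rw [hAE]
      refine le_trans ?_ (sum_le_sum_of_subset (filter_subset
        (fun a => ¬ A.card * d a ≤ 2 * energy A) A))
      rw [← smul_eq_mul]
      refine card_nsmul_le_sum _ _ _ fun x hx => ?_
      have := (mem_filter.1 hx).2
      omega
    have h2 : 2 * (A.filter (fun a => ¬ A.card * d a ≤ 2 * energy A)).card ≤ A.card := by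
      refine Nat.le_of_mul_le_mul_right ?_ hEpos
      linarith
    omega
  · intro T hT
    unfold crossE
    rw [mul_sum, ← smul_eq_mul (a := T.card)]
    refine sum_le_card_nsmul _ _ _ fun a ha => ?_
    refine le_trans ?_ (mem_filter.1 (hT ha)).2
    refine Nat.mul_le_mul_left _ ?_
    exact sum_le_sum_of_subset (hT.trans (filter_subset _ _))

/-- The arithmetic at the end: `n = |A|`, `k = |B|`, `b = |B_s|`, `m = |A ± A_s|`. -/
theorem final_arith (n k b m e x y γ : ℝ) (hn : 0 < n) (hb : 0 < b) (hm : 0 ≤ m) (he : 0 < e)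
    (hγ : γ ≤ 1) (hk : n ≤ 2 * k)
    (hx : x ≤ 2 * b ^ 3) (hy : n * y ≤ b * (2 * e))
    (h1 : k ^ 2 * b ^ 2 ≤ m * x) (h2 : n ^ 2 * b ^ 2 ≤ m * y) :
    1 / 16 * γ * n ^ 5 / e ≤ m ^ 2 := by
  have hb2 : 0 < b ^ 2 := by positivity
  have p1 : n ^ 2 ≤ 8 * (m * b) := by
    have a1 : k ^ 2 * b ^ 2 ≤ (m * (2 * b)) * b ^ 2 := by
      nlinarith [mul_le_mul_of_nonneg_left hx hm]
    have a2 := le_of_mul_le_mul_right a1 hb2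
    nlinarith
  have p2 : n ^ 3 * b ≤ 2 * (m * e) := by
    have a1 : (n ^ 3 * b) * b ≤ (2 * (m * e)) * b := by
      nlinarith [mul_le_mul_of_nonneg_left hy hm, mul_le_mul_of_nonneg_left h2 hn.le]
    exact le_of_mul_le_mul_right a1 hb
  have p3 : n ^ 5 * b ≤ (16 * m ^ 2 * e) * b := by
    have := mul_le_mul p1 p2 (by positivity) (by positivity)
    nlinarith
  have p4 := le_of_mul_le_mul_right p3 hb
  rw [div_le_iff₀ he]
  have : γ * n ^ 5 ≤ 1 * n ^ 5 := mul_le_mul_of_nonneg_right hγ (by positivity)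
  nlinarith

theorem stmt_4 :
    ∃ c : ℝ, 0 < c ∧
      ∀ (G : Type u) [AddCommGroup G] [DecidableEq G] (A : Finset G) (β γ : ℝ),
        A.Nonempty →
        0 < β → β ≤ 1 / 2 → 0 < γ → γ ≤ 1 →
        conn 3 β γ A →
        2 ^ 4 * γ⁻¹ * (A.card : ℝ) ^ 3 ≤ (energyK 3 A : ℝ) →
        (∃ s : G, s ≠ 0 ∧
            c * γ * (A.card : ℝ) ^ 5 / (energy A : ℝ) ≤ ((A - stab A s).card : ℝ) ^ 2) ∧
        (∃ s : G, s ≠ 0 ∧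
            c * γ * (A.card : ℝ) ^ 5 / (energy A : ℝ) ≤ ((A + stab A s).card : ℝ) ^ 2) := by
  refine ⟨1 / 16, by norm_num, ?_⟩
  intro G _ _ A β γ hA hβ hβ2 hγ hγ1 hconn hE3
  obtain ⟨B, hBA, hcard, hB⟩ := exists_sub A hA
  have hn : (0 : ℝ) < A.card := by exact_mod_cast hA.card_pos
  have hk : (A.card : ℝ) ≤ 2 * B.card := by exact_mod_cast hcard
  have hkpos : (0 : ℝ) < B.card := by linarith
  have hBne : B.Nonempty := card_pos.1 (by exact_mod_cast hkpos)
  have he : (0 : ℝ) < energy A := by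
    have : 0 < energy A := by
      rw [energy_eq, ← addEnergy_eq_crossE]; exact addEnergy_self_pos hA
    exact_mod_cast this
  have h3 : 2 * B.card ^ 3 ≤ energyK 3 B := by
    have hc := hconn B hBA (by nlinarith)
    obtain ⟨r, hr⟩ : ∃ r : ℝ, r = (B.card : ℝ) / A.card := ⟨_, rfl⟩
    rw [← hr] at hc
    have hr2 : 1 / 2 ≤ r := by
      rw [hr, le_div_iff₀ hn]; linarith
    have hkr : (B.card : ℝ) = r * A.card := by rw [hr]; field_simp
    have q1 : γ * r ^ (2 * 3) * (2 ^ 4 * γ⁻¹ * (A.card : ℝ) ^ 3) ≤ energyK 3 B :=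
      le_trans (mul_le_mul_of_nonneg_left hE3 (mul_nonneg hγ.le (pow_nonneg (by linarith) _))) hc
    have q2 : γ * r ^ (2 * 3) * (2 ^ 4 * γ⁻¹ * (A.card : ℝ) ^ 3)
        = 16 * r ^ 3 * (B.card : ℝ) ^ 3 := by
      have hg : γ * γ⁻¹ = 1 := mul_inv_cancel₀ hγ.ne'
      calc γ * r ^ (2 * 3) * (2 ^ 4 * γ⁻¹ * (A.card : ℝ) ^ 3)
          = (γ * γ⁻¹) * (16 * r ^ 3 * (r * (A.card : ℝ)) ^ 3) := by ring
        _ = _ := by rw [hg, one_mul, ← hkr]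
    have q3 : (1 / 2 : ℝ) ^ 3 ≤ r ^ 3 := pow_le_pow_left₀ (by norm_num) hr2 3
    have q4 : 2 * (B.card : ℝ) ^ 3 ≤ 16 * r ^ 3 * (B.card : ℝ) ^ 3 := by
      refine mul_le_mul_of_nonneg_right ?_ (pow_nonneg hkpos.le 3)
      linarith
    rw [q2] at q1
    exact_mod_cast q4.trans q1
  obtain ⟨s, hs0, hsne, hs⟩ := exists_good B hBne h3
  have hsB : stab B s ⊆ B := fun x hx => ((mem_stab' B s x).1 hx).1
  have hy := hB _ hsB
  have hb : (0 : ℝ) < (stab B s).card := by exact_mod_cast hsne.card_pos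
  have hsA := stab_mono' hBA s
  have key : ∀ m : ℕ, B.card ^ 2 * (stab B s).card ^ 2 ≤ m * crossE B (stab B s) →
      A.card ^ 2 * (stab B s).card ^ 2 ≤ m * crossE A (stab B s) →
      1 / 16 * γ * (A.card : ℝ) ^ 5 / (energy A : ℝ) ≤ (m : ℝ) ^ 2 := by
    intro m h1 h2
    exact final_arith A.card B.card (stab B s).card m (energy A) (crossE B (stab B s))
      (crossE A (stab B s)) γ hn hb (by positivity) he hγ1 hk (by exact_mod_cast hs)
      (by exact_mod_cast hy) (by exact_mod_cast h1) (by exact_mod_cast h2)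
  refine ⟨⟨s, hs0, key _ ?_ ?_⟩, ⟨s, hs0, key _ ?_ ?_⟩⟩
  · exact (cs_sub _ _).trans (Nat.mul_le_mul_right _ (card_le_card (sub_subset_sub hBA hsA)))
  · exact (cs_sub _ _).trans
      (Nat.mul_le_mul_right _ (card_le_card (sub_subset_sub Subset.rfl hsA)))
  · exact (cs_add _ _).trans (Nat.mul_le_mul_right _ (card_le_card (add_subset_add hBA hsA)))
  · exact (cs_add _ _).trans
      (Nat.mul_le_mul_right _ (card_le_card (add_subset_add Subset.rfl hsA)))
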